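/- For every integer m ≥ 2, the free group F_2 of rank 2 embeds into the dihedral Artin group D_m if and only if m > 2. -/

import Mathlib

/-- The alternating product `u v u v …` of length `m`. -/
def altProd {G : Type*} [Monoid G] (u v : G) (m : ℕ) : G :=
  ((List.range m).map (fun i => if i % 2 = 0 then u else v)).prod

/-- Relations of the Artin group of an Artin graph `(G, ℓ)`:
`(u,v)_{ℓ u v} = (v,u)_{ℓ u v}` for each edge `{u,v}`. -/
def artinRels {V : Type*} (G : SimpleGraph V) (ℓ : V → V → ℕ) : Set (FreeGroup V) :=
  {r | ∃ u v : V, G.Adj u v ∧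
    r = altProd (FreeGroup.of u) (FreeGroup.of v) (ℓ u v) *
        (altProd (FreeGroup.of v) (FreeGroup.of u) (ℓ u v))⁻¹}

/-- The Artin group of an Artin graph `(G, ℓ)`. -/
abbrev ArtinGroup {V : Type*} (G : SimpleGraph V) (ℓ : V → V → ℕ) :=
  PresentedGroup (artinRels G ℓ)

/-- The dihedral Artin group `D_m = ⟨a, b ∣ (a,b)_m = (b,a)_m⟩`, as the Artin group of a
single edge labeled `m`; the generator `a` is `PresentedGroup.of 0`, and `b` is
`PresentedGroup.of 1`. -/
abbrev DihedralArtin (m : ℕ) : Type :=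
  ArtinGroup (⊤ : SimpleGraph (Fin 2)) (fun _ _ => m)

open scoped MatrixGroups

lemma altProd_even {G : Type*} [Monoid G] (u v : G) (k : ℕ) :
    altProd u v (2 * k) = (u * v) ^ k := by
  induction k with
  | zero => simp [altProd]
  | succ k ih =>
    have h : 2 * (k + 1) = 2 * k + 1 + 1 := by ring
    unfold altProd at ih ⊢
    rw [h, List.range_succ, List.range_succ, pow_succ, ← ih]
    simp [Nat.add_mod]

lemma altProd_odd {G : Type*} [Monoid G] (u v : G) (k : ℕ) :
    altProd u v (2 * k + 1) = (u * v) ^ k * u := by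
  have := altProd_even u v k
  unfold altProd at this ⊢
  rw [List.range_succ, ← this]
  simp

lemma map_altProd {G H : Type*} [Monoid G] [Monoid H] (f : G →* H) (u v : G) (k : ℕ) :
    f (altProd u v k) = altProd (f u) (f v) k := by
  unfold altProd
  rw [map_list_prod, List.map_map]
  congr 2
  funext i
  simp [apply_ite f]

def upM (x : ℝ) : GL (Fin 2) ℝ :=
  ⟨!![1, x; 0, 1], !![1, -x; 0, 1], by simp [Matrix.one_fin_two],
    by simp [Matrix.one_fin_two]⟩

def loM (x : ℝ) : GL (Fin 2) ℝ :=
  ⟨!![1, 0; -x, 1], !![1, 0; x, 1], by simp [Matrix.one_fin_two],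
    by simp [Matrix.one_fin_two]⟩

lemma upM_sq (x : ℝ) : upM x ^ 2 = upM (2 * x) := by
  apply Units.ext
  simp [upM, pow_two]
  ring

lemma loM_sq (x : ℝ) : loM x ^ 2 = loM (2 * x) := by
  apply Units.ext
  simp [loM, pow_two]
  ring

lemma upM_inv (x : ℝ) : (upM x)⁻¹ = upM (-x) := by
  apply Units.ext
  rfl

lemma loM_inv (x : ℝ) : (loM x)⁻¹ = loM (-x) := by
  apply Units.ext
  change !![1, 0; x, 1] = !![1, 0; - -x, 1]
  simp

lemma pow_formula (θ : ℝ) (k : ℕ) :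
    Real.sin θ • ((!![1, 2 * Real.cos θ; 0, 1] * !![1, 0; -(2 * Real.cos θ), 1] :
      Matrix (Fin 2) (Fin 2) ℝ)) ^ k =
    (-1 : ℝ) ^ k • !![Real.sin (2 * k * θ + θ), -Real.sin (2 * k * θ);
      Real.sin (2 * k * θ), -Real.sin (2 * k * θ - θ)] := by
  induction k with
  | zero =>
    ext i j
    fin_cases i <;> fin_cases j <;> simp
  | succ k ih =>
    rw [pow_succ, ← smul_mul_assoc, ih, pow_succ]
    have e : 2 * ((k + 1 : ℕ) : ℝ) * θ = 2 * k * θ + θ + θ := by push_cast; ring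
    rw [e]
    have e2 : 2 * (k : ℝ) * θ + θ + θ - θ = 2 * k * θ + θ := by ring
    rw [e2]
    generalize 2 * (k : ℝ) * θ = φ
    have h := Real.sin_sq_add_cos_sq θ
    have h2 : Real.sin θ ^ 2 = 1 - Real.cos θ ^ 2 := by linarith
    generalize (-1 : ℝ) ^ k = ε
    ext i j
    fin_cases i <;> fin_cases j <;>
      simp [Real.sin_add, Real.sin_sub, Real.cos_add] <;> ring_nf <;>
      (try rw [show Real.sin θ ^ 3 = Real.sin θ * Real.sin θ ^ 2 by ring]) <;>
      (try rw [h2]) <;> ring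

lemma artin_rel (m : ℕ) (hm : 2 < m) :
    altProd (upM (2 * Real.cos (Real.pi / m))) (loM (2 * Real.cos (Real.pi / m))) m =
    altProd (loM (2 * Real.cos (Real.pi / m))) (upM (2 * Real.cos (Real.pi / m))) m := by
  have hm' : (2 : ℝ) < m := by exact_mod_cast hm
  obtain ⟨θ, hθ⟩ : ∃ θ, θ = Real.pi / m := ⟨_, rfl⟩
  have hmθ : m * θ = Real.pi := by rw [hθ]; field_simp
  have hθ0 : 0 < θ := by rw [hθ]; positivity
  have hθ1 : θ < Real.pi := by nlinarith
  have hs : Real.sin θ ≠ 0 := (Real.sin_pos_of_pos_of_lt_pi hθ0 hθ1).ne'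
  rw [← hθ]
  rcases Nat.even_or_odd' m with ⟨k, rfl | rfl⟩
  · rw [altProd_even, altProd_even]
    have hc : upM (2 * Real.cos θ) * (loM (2 * Real.cos θ) * upM (2 * Real.cos θ)) ^ k =
        (upM (2 * Real.cos θ) * loM (2 * Real.cos θ)) ^ k * upM (2 * Real.cos θ) :=
      (mul_pow_mul _ _ _).symm
    apply mul_left_cancel (a := upM (2 * Real.cos θ))
    rw [hc]
    apply Units.ext
    apply smul_right_injective _ hs
    have h := pow_formula θ k
    push_cast at hmθ
    rw [hmθ] at h
    simp only [Units.val_mul, Units.val_pow_eq_pow_val]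
    change Real.sin θ • (!![1, 2 * Real.cos θ; 0, 1] * (!![1, 2 * Real.cos θ; 0, 1] * !![1, 0; -(2 * Real.cos θ), 1] :
      Matrix (Fin 2) (Fin 2) ℝ) ^ k) = Real.sin θ • ((!![1, 2 * Real.cos θ; 0, 1] * !![1, 0; -(2 * Real.cos θ), 1] :
      Matrix (Fin 2) (Fin 2) ℝ) ^ k * !![1, 2 * Real.cos θ; 0, 1])
    rw [← mul_smul_comm, ← smul_mul_assoc, h]
    generalize (-1 : ℝ) ^ k = ε
    ext i j
    fin_cases i <;> fin_cases j <;> simp [Real.sin_add, Real.sin_sub] <;> ring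
  · rw [altProd_odd, altProd_odd]
    have hc : (loM (2 * Real.cos θ) * upM (2 * Real.cos θ)) ^ k * loM (2 * Real.cos θ) =
        loM (2 * Real.cos θ) * (upM (2 * Real.cos θ) * loM (2 * Real.cos θ)) ^ k :=
      mul_pow_mul _ _ _
    rw [hc]
    apply Units.ext
    apply smul_right_injective _ hs
    have h := pow_formula θ k
    push_cast at hmθ
    have e : 2 * (k : ℝ) * θ = Real.pi - θ := by linarith
    rw [e] at h
    simp only [Units.val_mul, Units.val_pow_eq_pow_val]
    change Real.sin θ • ((!![1, 2 * Real.cos θ; 0, 1] * !![1, 0; -(2 * Real.cos θ), 1] :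
      Matrix (Fin 2) (Fin 2) ℝ) ^ k * !![1, 2 * Real.cos θ; 0, 1]) =
      Real.sin θ • (!![1, 0; -(2 * Real.cos θ), 1] * (!![1, 2 * Real.cos θ; 0, 1] * !![1, 0; -(2 * Real.cos θ), 1] :
      Matrix (Fin 2) (Fin 2) ℝ) ^ k)
    rw [← smul_mul_assoc, ← mul_smul_comm, h]
    generalize (-1 : ℝ) ^ k = ε
    ext i j
    fin_cases i <;> fin_cases j <;> simp [Real.sin_sub, Real.cos_sub] <;> ring

lemma upM_infty (x : ℝ) : upM x • (OnePoint.infty : OnePoint ℝ) = OnePoint.infty := by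
  simp [OnePoint.smul_infty_eq_ite, upM]

lemma upM_coe (x t : ℝ) : upM x • (t : OnePoint ℝ) = ((t + x : ℝ) : OnePoint ℝ) := by
  simp [OnePoint.smul_some_eq_ite, upM]

lemma loM_infty (x : ℝ) (hx : x ≠ 0) :
    loM x • (OnePoint.infty : OnePoint ℝ) = ((1 / (-x) : ℝ) : OnePoint ℝ) := by
  simp [OnePoint.smul_infty_eq_ite, loM, hx]

lemma loM_coe (x t : ℝ) (h : -x * t + 1 ≠ 0) :
    loM x • (t : OnePoint ℝ) = ((t / (-x * t + 1) : ℝ) : OnePoint ℝ) := by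
  rw [OnePoint.smul_some_eq_ite]
  simp [loM] at h ⊢
  simp [h]

def pX : Fin 2 → Set (OnePoint ℝ) :=
  ![insert OnePoint.infty ((↑) '' Set.Ici (1 : ℝ)), (↑) '' Set.Icc (-1 : ℝ) 0]

def pY : Fin 2 → Set (OnePoint ℝ) :=
  ![(↑) '' Set.Iio (-1 : ℝ), (↑) '' Set.Ioo (0 : ℝ) 1]

lemma free_pair (x : ℝ) (hx : 2 ≤ x) :
    Function.Injective (FreeGroup.lift ![upM x, loM x]) := by
  have cc : ∀ (t : ℝ) (S : Set ℝ), (t : OnePoint ℝ) ∈ ((↑) '' S : Set (OnePoint ℝ)) ↔ t ∈ S := by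
    intro t S; simp
  have ci : ∀ (S : Set ℝ), (OnePoint.infty : OnePoint ℝ) ∉ ((↑) '' S : Set (OnePoint ℝ)) := by
    intro S; simp
  apply FreeGroup.injective_lift_of_ping_pong _ pX pY
  · intro i
    fin_cases i
    · exact ⟨OnePoint.infty, by simp [pX]⟩
    · exact ⟨((0 : ℝ) : OnePoint ℝ), by simp [pX]⟩
  · intro i j hij
    rw [Function.onFun, Set.disjoint_left]
    intro p
    induction p using OnePoint.rec <;> fin_cases i <;> fin_cases j <;>
      simp [pX] at hij ⊢ <;> intros <;> linarith
  · intro i j hij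
    rw [Function.onFun, Set.disjoint_left]
    intro p
    induction p using OnePoint.rec <;> fin_cases i <;> fin_cases j <;>
      simp [pY] at hij ⊢ <;> intros <;> linarith
  · intro i j
    rw [Set.disjoint_left]
    intro p
    induction p using OnePoint.rec <;> fin_cases i <;> fin_cases j <;>
      simp [pX, pY] <;> intros <;> linarith
  · intro i
    rintro _ ⟨p, hp, rfl⟩
    fin_cases i
    · change p ∉ ((↑) '' Set.Iio (-1 : ℝ) : Set (OnePoint ℝ)) at hp
      change upM x • p ∈ insert OnePoint.infty ((↑) '' Set.Ici (1 : ℝ))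
      induction p using OnePoint.rec with
      | infty => rw [upM_infty]; simp
      | coe t =>
        rw [upM_coe]; right
        rw [cc] at hp ⊢
        simp at hp ⊢; linarith
    · change p ∉ ((↑) '' Set.Ioo (0 : ℝ) 1 : Set (OnePoint ℝ)) at hp
      change loM x • p ∈ ((↑) '' Set.Icc (-1 : ℝ) 0 : Set (OnePoint ℝ))
      induction p using OnePoint.rec with
      | infty =>
        rw [loM_infty _ (by linarith), cc, one_div_neg_eq_neg_one_div, Set.mem_Icc]
        have h1 : 0 < 1 / x := by positivity
        have h2 : 1 / x ≤ 1 := by rw [div_le_one (by linarith)]; linarith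
        constructor <;> linarith
      | coe t =>
        rw [cc, Set.mem_Ioo, not_and_or, not_lt, not_lt] at hp
        rcases hp with hp | hp
        · have hd : 0 < -x * t + 1 := by nlinarith
          rw [loM_coe _ _ hd.ne', cc]
          constructor
          · rw [le_div_iff₀ hd]; nlinarith
          · rw [div_le_iff₀ hd]; nlinarith
        · have hd : -x * t + 1 < 0 := by nlinarith
          rw [loM_coe _ _ hd.ne, cc]
          constructor
          · rw [le_div_iff_of_neg hd]; nlinarith
          · rw [div_le_iff_of_neg hd]; nlinarith
  · intro i
    rintro _ ⟨p, hp, rfl⟩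
    fin_cases i
    · change p ∉ insert OnePoint.infty ((↑) '' Set.Ici (1 : ℝ)) at hp
      change (upM x)⁻¹ • p ∈ ((↑) '' Set.Iio (-1 : ℝ) : Set (OnePoint ℝ))
      rw [upM_inv]
      induction p using OnePoint.rec with
      | infty => simp at hp
      | coe t =>
        rw [upM_coe, cc]
        simp at hp ⊢; linarith
    · change p ∉ ((↑) '' Set.Icc (-1 : ℝ) 0 : Set (OnePoint ℝ)) at hp
      change (loM x)⁻¹ • p ∈ ((↑) '' Set.Ioo (0 : ℝ) 1 : Set (OnePoint ℝ))
      rw [loM_inv]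
      induction p using OnePoint.rec with
      | infty =>
        rw [loM_infty _ (by linarith), cc, neg_neg, Set.mem_Ioo]
        have h1 : 0 < 1 / x := by positivity
        have h2 : 1 / x < 1 := by rw [div_lt_one (by linarith)]; linarith
        constructor <;> linarith
      | coe t =>
        rw [cc, Set.mem_Icc, not_and_or, not_le, not_le] at hp
        rcases hp with hp | hp
        · have hd : - -x * t + 1 < 0 := by nlinarith
          rw [loM_coe _ _ hd.ne, cc]
          constructor
          · rw [lt_div_iff_of_neg hd]; nlinarith
          · rw [div_lt_iff_of_neg hd]; nlinarith
        · have hd : 0 < - -x * t + 1 := by nlinarith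
          rw [loM_coe _ _ hd.ne', cc]
          constructor
          · rw [lt_div_iff₀ hd]; nlinarith
          · rw [div_lt_iff₀ hd]; nlinarith

lemma comm_two (x y : DihedralArtin 2) : x * y = y * x := by
  have h01 : (PresentedGroup.of 0 : DihedralArtin 2) * PresentedGroup.of 1 =
      PresentedGroup.of 1 * PresentedGroup.of 0 := by
    have h : PresentedGroup.mk (artinRels (⊤ : SimpleGraph (Fin 2)) (fun _ _ => 2))
        (altProd (FreeGroup.of 0) (FreeGroup.of 1) 2 *
        (altProd (FreeGroup.of 1) (FreeGroup.of 0) 2)⁻¹) = 1 :=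
      PresentedGroup.one_of_mem ⟨0, 1, by simp, rfl⟩
    rw [map_mul, map_inv, mul_inv_eq_one, map_altProd, map_altProd] at h
    simp [altProd, List.range_succ] at h
    exact h
  have hgen : ∀ i j : Fin 2, Commute (PresentedGroup.of i : DihedralArtin 2)
      (PresentedGroup.of j) := by
    intro i j
    fin_cases i <;> fin_cases j
    · exact Commute.refl _
    · exact h01
    · exact h01.symm
    · exact Commute.refl _
  have key : ∀ (i : Fin 2) (y : DihedralArtin 2), Commute (PresentedGroup.of i) y := by
    intro i y
    induction y using PresentedGroup.induction_on with
    | _ z =>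
      induction z using FreeGroup.induction_on with
      | C1 => simp
      | of j => exact hgen i j
      | inv_of j h => rw [map_inv]; exact h.inv_right
      | mul a b ha hb => rw [map_mul]; exact ha.mul_right hb
  induction x using PresentedGroup.induction_on with
  | _ z =>
    change Commute _ _
    induction z using FreeGroup.induction_on with
    | C1 => simp
    | of j => exact key j y
    | inv_of j h => rw [map_inv]; exact h.inv_left
    | mul a b ha hb => rw [map_mul]; exact ha.mul_left hb

/-- For `m ≥ 2`, the free group of rank `2` embeds into the dihedral Artin
group `D_m` if and only if `m > 2`. -/
theorem stmt_5 (m : ℕ) (hm : 2 ≤ m) :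
    (∃ f : FreeGroup (Fin 2) →* DihedralArtin m, Function.Injective f) ↔ 2 < m := by
  constructor
  · rintro ⟨f, hf⟩
    by_contra hlt
    obtain rfl : m = 2 := by omega
    have h : (FreeGroup.of 0 * FreeGroup.of 1 : FreeGroup (Fin 2)) =
        FreeGroup.of 1 * FreeGroup.of 0 := by
      apply hf
      rw [map_mul, map_mul, comm_two]
    have := congrArg FreeGroup.toWord h
    revert this
    decide
  · intro h
    have hrel := artin_rel m h
    have hm' : (3 : ℝ) ≤ m := by exact_mod_cast h
    have hcos : 1 / 2 ≤ Real.cos (Real.pi / m) := by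
      rw [← Real.cos_pi_div_three]
      apply Real.cos_le_cos_of_nonneg_of_le_pi
      · positivity
      · have := Real.pi_pos; linarith
      · exact div_le_div_of_nonneg_left Real.pi_pos.le (by norm_num) hm'
    have hl : 1 ≤ 2 * Real.cos (Real.pi / m) := by linarith
    generalize 2 * Real.cos (Real.pi / m) = l at hrel hl
    have hr : ∀ r ∈ artinRels (⊤ : SimpleGraph (Fin 2)) (fun _ _ => m),
        FreeGroup.lift ![upM l, loM l] r = 1 := by
      rintro r ⟨u, v, huv, rfl⟩
      rw [map_mul, map_inv, mul_inv_eq_one, map_altProd, map_altProd, FreeGroup.lift_apply_of,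
        FreeGroup.lift_apply_of]
      fin_cases u <;> fin_cases v
      · simp at huv
      · exact hrel
      · exact hrel.symm
      · simp at huv
    refine ⟨FreeGroup.lift fun i => (PresentedGroup.of i) ^ 2, ?_⟩
    apply Function.Injective.of_comp (f := PresentedGroup.toGroup hr)
    rw [← MonoidHom.coe_comp]
    convert free_pair (2 * l) (by linarith) using 2
    ext i : 1
    rw [MonoidHom.comp_apply, FreeGroup.lift_apply_of, FreeGroup.lift_apply_of, map_pow,
      PresentedGroup.toGroup.of]
    fin_cases i
    · exact upM_sq l
    · exact loM_sq l
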